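/- In the fast diffusion setting below, there exists a constant C > 0, depending only on n, Ω, b, T, p, c₀ and ∫_Ω |∇u(x,0)|² dx, such that ∂_t u(x,t) ≤ C d(x) for all (x,t) ∈ closure(Ω) × [T/2, T]. -/

import Mathlib

open MeasureTheory Real Set

noncomputable section

/-- Partial derivative in the `i`-th coordinate direction. -/
def pderiv' {n : ℕ} (i : Fin n) (f : EuclideanSpace ℝ (Fin n) → ℝ)
    (x : EuclideanSpace ℝ (Fin n)) : ℝ :=
  fderiv ℝ f x (EuclideanSpace.single i 1)

/-- The Laplacian `Δf = ∑ᵢ ∂ᵢ∂ᵢ f`. -/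
def lap {n : ℕ} (f : EuclideanSpace ℝ (Fin n) → ℝ) (x : EuclideanSpace ℝ (Fin n)) : ℝ :=
  ∑ i, pderiv' i (pderiv' i f) x

/-- Distance to the boundary of `Ω`. -/
def dB {n : ℕ} (Ω : Set (EuclideanSpace ℝ (Fin n))) (x : EuclideanSpace ℝ (Fin n)) : ℝ :=
  Metric.infDist x (frontier Ω)

/-- A smooth bounded domain: a nonempty bounded open set which is the sublevel set
of a smooth defining function with nonvanishing gradient on the boundary. -/
def IsSmoothDomain {n : ℕ} (Ω : Set (EuclideanSpace ℝ (Fin n))) : Prop :=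
  IsOpen Ω ∧ Bornology.IsBounded Ω ∧ Ω.Nonempty ∧
    ∃ Φ : EuclideanSpace ℝ (Fin n) → ℝ, ContDiff ℝ (⊤ : ℕ∞) Φ ∧
      Ω = {x | Φ x < 0} ∧ frontier Ω = {x | Φ x = 0} ∧
      ∀ x ∈ frontier Ω, gradient Φ x ≠ 0

/-- A function on `Ω × [0,T]` extends continuously to `closure Ω × [0,T]`. -/
def ExtendsCont {n : ℕ} (Ω : Set (EuclideanSpace ℝ (Fin n))) (T : ℝ)
    (f : EuclideanSpace ℝ (Fin n) → ℝ → ℝ) : Prop :=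
  ∃ g : EuclideanSpace ℝ (Fin n) → ℝ → ℝ,
    ContinuousOn (fun z : EuclideanSpace ℝ (Fin n) × ℝ => g z.1 z.2)
      (closure Ω ×ˢ Set.Icc 0 T) ∧
    ∀ x ∈ Ω, ∀ t ∈ Set.Icc 0 T, g x t = f x t

/-- Membership in `C^{3,2}(closure Ω × [0,T])`, with the first and second time
derivatives recorded as the functions `ut` and `utt`:  `u`, `D_x u`, `D_x² u`,
`D_x³ u`, `∂ₜ u`, `D_x ∂ₜ u`, `D_x² ∂ₜ u`, `∂ₜ² u` all extend continuously to
`closure Ω × [0,T]`. -/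
def C32 {n : ℕ} (Ω : Set (EuclideanSpace ℝ (Fin n))) (T : ℝ)
    (u ut utt : EuclideanSpace ℝ (Fin n) → ℝ → ℝ) : Prop :=
  (∀ t ∈ Set.Icc (0 : ℝ) T, ContDiffOn ℝ 3 (fun x => u x t) Ω) ∧
  (∀ t ∈ Set.Icc (0 : ℝ) T, ContDiffOn ℝ 2 (fun x => ut x t) Ω) ∧
  (∀ x ∈ Ω, ∀ t ∈ Set.Icc (0 : ℝ) T, HasDerivWithinAt (u x) (ut x t) (Set.Icc 0 T) t) ∧
  (∀ x ∈ Ω, ∀ t ∈ Set.Icc (0 : ℝ) T, HasDerivWithinAt (ut x) (utt x t) (Set.Icc 0 T) t) ∧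
  ContinuousOn (fun z : EuclideanSpace ℝ (Fin n) × ℝ => u z.1 z.2)
    (closure Ω ×ˢ Set.Icc 0 T) ∧
  ContinuousOn (fun z : EuclideanSpace ℝ (Fin n) × ℝ => ut z.1 z.2)
    (closure Ω ×ˢ Set.Icc 0 T) ∧
  ContinuousOn (fun z : EuclideanSpace ℝ (Fin n) × ℝ => utt z.1 z.2)
    (closure Ω ×ˢ Set.Icc 0 T) ∧
  (∀ i : Fin n, ExtendsCont Ω T fun x t => pderiv' i (fun y => u y t) x) ∧
  (∀ i j : Fin n, ExtendsCont Ω T fun x t => pderiv' i (pderiv' j fun y => u y t) x) ∧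
  (∀ i j k : Fin n,
    ExtendsCont Ω T fun x t => pderiv' i (pderiv' j (pderiv' k fun y => u y t)) x) ∧
  (∀ i : Fin n, ExtendsCont Ω T fun x t => pderiv' i (fun y => ut y t) x) ∧
  (∀ i j : Fin n, ExtendsCont Ω T fun x t => pderiv' i (pderiv' j fun y => ut y t) x)

/-- The fast diffusion setting of Section 4 of the paper: `u ∈ C^{3,2}(closure Ω × [0,T])`
is positive in `Ω × [0,T]`, solves `∂ₜ(u^p) = Δu + bu + u^p` in `Ω × (0,T]`, vanishes
on `∂Ω × [0,T]`, and is comparable to the distance to the boundary. -/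
def FDSetting {n : ℕ} (Ω : Set (EuclideanSpace ℝ (Fin n))) (p b T c₀ : ℝ)
    (u ut utt : EuclideanSpace ℝ (Fin n) → ℝ → ℝ) : Prop :=
  IsSmoothDomain Ω ∧ 1 < p ∧ (n ≤ 2 ∨ p ≤ ((n : ℝ) + 2) / ((n : ℝ) - 2)) ∧
  0 < T ∧ 1 ≤ c₀ ∧
  C32 Ω T u ut utt ∧
  (∀ x ∈ Ω, ∀ t ∈ Set.Icc (0 : ℝ) T, 0 < u x t) ∧
  (∀ x ∈ Ω, ∀ t ∈ Set.Ioc (0 : ℝ) T,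
      HasDerivWithinAt (fun s => u x s ^ p)
        (lap (fun y => u y t) x + b * u x t + u x t ^ p) (Set.Icc 0 T) t) ∧
  (∀ x ∈ frontier Ω, ∀ t ∈ Set.Icc (0 : ℝ) T, u x t = 0) ∧
  (∀ x ∈ Ω, ∀ t ∈ Set.Icc (0 : ℝ) T,
      c₀⁻¹ * dB Ω x ≤ u x t ∧ u x t ≤ c₀ * dB Ω x)

open Filter Topology

/-- Second order necessary condition at a local maximum on the line. -/
lemma second_deriv_nonpos_of_isLocalMax {φ φ' : ℝ → ℝ} {a x : ℝ} (hmax : IsLocalMax φ x)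
    (h1 : ∀ᶠ r in 𝓝 x, HasDerivAt φ (φ' r) r) (h2 : HasDerivAt φ' a x) : a ≤ 0 := by
  by_contra! ha
  have hd : deriv φ =ᶠ[𝓝 x] φ' := h1.mono fun r hr => hr.deriv
  have hdd : deriv (deriv φ) x = a := by rw [hd.deriv_eq, h2.deriv]
  have hmin : IsLocalMin φ x :=
    isLocalMin_of_deriv_deriv_pos (by rwa [hdd]) hmax.deriv_eq_zero h1.self_of_nhds.continuousAt
  have hconst : φ =ᶠ[𝓝 x] fun _ => φ x := by
    filter_upwards [hmax, hmin] with y h h' using le_antisymm h h'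
  have h0 : deriv φ =ᶠ[𝓝 x] fun _ => 0 := by
    simpa using hconst.deriv
  have : deriv (deriv φ) x = 0 := by rw [h0.deriv_eq]; simp
  linarith

/-- First order condition in time at a maximum over the past. -/
lemma deriv_nonneg_of_le_past {φ : ℝ → ℝ} {a τ t : ℝ} (hτ : τ < t)
    (h : HasDerivWithinAt φ a (Icc τ t) t) (hle : ∀ s ∈ Icc τ t, φ s ≤ φ t) : 0 ≤ a := by
  have h' := (h.mono Ico_subset_Icc_self)
  rw [hasDerivWithinAt_iff_tendsto_slope' (by simp)] at h'
  have : (𝓝[Ico τ t] t).NeBot := by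
    rw [← mem_closure_iff_nhdsWithin_neBot, closure_Ico hτ.ne]
    exact right_mem_Icc.2 hτ.le
  refine ge_of_tendsto h' ?_
  filter_upwards [self_mem_nhdsWithin] with s hs
  rw [slope_def_field]
  exact div_nonneg_of_nonpos (by linarith [hle s (Ico_subset_Icc_self hs)]) (by linarith [hs.2])

lemma hasDerivAt_line {n : ℕ} (i : Fin n) {f : EuclideanSpace ℝ (Fin n) → ℝ}
    {x : EuclideanSpace ℝ (Fin n)} {r : ℝ}
    (hf : DifferentiableAt ℝ f (x + r • EuclideanSpace.single i 1)) :
    HasDerivAt (fun r : ℝ => f (x + r • EuclideanSpace.single i (1 : ℝ)))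
      (pderiv' i f (x + r • EuclideanSpace.single i 1)) r := by
  have hl : HasDerivAt (fun r : ℝ => x + r • EuclideanSpace.single i (1 : ℝ))
      (EuclideanSpace.single i (1 : ℝ)) r := by
    simpa using ((hasDerivAt_id r).smul_const (EuclideanSpace.single i (1 : ℝ))).const_add x
  exact hf.hasFDerivAt.comp_hasDerivAt r hl

lemma contDiffOn_pderiv' {n : ℕ} {Ω : Set (EuclideanSpace ℝ (Fin n))} (hΩ : IsOpen Ω) (i : Fin n)
    {f : EuclideanSpace ℝ (Fin n) → ℝ} {m k : WithTop ℕ∞} (hf : ContDiffOn ℝ m f Ω)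
    (hmk : k + 1 ≤ m) : ContDiffOn ℝ k (pderiv' i f) Ω :=
  (hf.fderiv_of_isOpen hΩ hmk).clm_apply contDiffOn_const

lemma tendsto_line {n : ℕ} (x e : EuclideanSpace ℝ (Fin n)) :
    Tendsto (fun r : ℝ => x + r • e) (𝓝 0) (𝓝 x) := by
  have : Continuous fun r : ℝ => x + r • e := by fun_prop
  simpa using this.tendsto 0

/-- The Laplacian of a `C²` combination is nonpositive at an interior maximum. -/
lemma lap_comb_nonpos {n : ℕ} {Ω : Set (EuclideanSpace ℝ (Fin n))} (hΩ : IsOpen Ω)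
    {f g h : EuclideanSpace ℝ (Fin n) → ℝ} (hf : ContDiffOn ℝ 2 f Ω) (hg : ContDiffOn ℝ 2 g Ω)
    (hh : ContDiffOn ℝ 2 h Ω) {α β : ℝ} {x : EuclideanSpace ℝ (Fin n)} (hx : x ∈ Ω)
    (hmax : ∀ y ∈ Ω, f y - α * g y - β * h y ≤ f x - α * g x - β * h x) :
    lap f x - α * lap g x - β * lap h x ≤ 0 := by
  have hmem : ∀ i : Fin n, ∀ᶠ r : ℝ in 𝓝 0, x + r • EuclideanSpace.single i (1 : ℝ) ∈ Ω :=
    fun i => (tendsto_line x _).eventually (hΩ.mem_nhds hx)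
  have key : ∀ i : Fin n, pderiv' i (pderiv' i f) x - α * pderiv' i (pderiv' i g) x
      - β * pderiv' i (pderiv' i h) x ≤ 0 := by
    intro i
    have d1 : ∀ {f : EuclideanSpace ℝ (Fin n) → ℝ}, ContDiffOn ℝ 2 f Ω → ∀ {r : ℝ},
        x + r • EuclideanSpace.single i (1 : ℝ) ∈ Ω →
        HasDerivAt (fun r : ℝ => f (x + r • EuclideanSpace.single i (1 : ℝ)))
          (pderiv' i f (x + r • EuclideanSpace.single i 1)) r := fun hf r hr =>
      hasDerivAt_line i ((hf.contDiffAt (hΩ.mem_nhds hr)).differentiableAt (by norm_num))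
    have d2 : ∀ {f : EuclideanSpace ℝ (Fin n) → ℝ}, ContDiffOn ℝ 2 f Ω →
        HasDerivAt (fun r : ℝ => pderiv' i f (x + r • EuclideanSpace.single i (1 : ℝ)))
          (pderiv' i (pderiv' i f) x) 0 := fun {f} hf => by
      have hf' : ContDiffOn ℝ 1 (pderiv' i f) Ω := contDiffOn_pderiv' hΩ i hf (by norm_num)
      have := hasDerivAt_line i (f := pderiv' i f) (x := x) (r := 0) (by
        simpa using (hf'.contDiffAt (hΩ.mem_nhds hx)).differentiableAt (by norm_num))
      simpa using this
    refine second_deriv_nonpos_of_isLocalMax (x := 0) (φ := fun r : ℝ =>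
        f (x + r • EuclideanSpace.single i (1 : ℝ)) - α * g (x + r • EuclideanSpace.single i (1 : ℝ))
          - β * h (x + r • EuclideanSpace.single i (1 : ℝ))) ?_ ?_
      (((d2 hf).sub ((d2 hg).const_mul α)).sub ((d2 hh).const_mul β))
    · filter_upwards [hmem i] with r hr
      simpa using hmax _ hr
    · filter_upwards [hmem i] with r hr
      exact ((d1 hf hr).sub ((d1 hg hr).const_mul α)).sub ((d1 hh hr).const_mul β)
  have := Finset.sum_nonpos fun i (_ : i ∈ Finset.univ) => key i
  simpa [lap, Finset.sum_sub_distrib, Finset.mul_sum] using this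

/-- Interchange of a time derivative and a space derivative. -/
lemma hasDerivWithinAt_pderiv' {n : ℕ} {Ω : Set (EuclideanSpace ℝ (Fin n))} (hΩ : IsOpen Ω)
    {T : ℝ} {g k : EuclideanSpace ℝ (Fin n) → ℝ → ℝ} (i : Fin n)
    (hg : ∀ t ∈ Icc 0 T, DifferentiableOn ℝ (fun x => g x t) Ω)
    (hk : ∀ t ∈ Icc 0 T, DifferentiableOn ℝ (fun x => k x t) Ω)
    (hgk : ∀ x ∈ Ω, ∀ t ∈ Icc 0 T, HasDerivWithinAt (g x) (k x t) (Icc 0 T) t)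
    (hext : ExtendsCont Ω T fun x t => pderiv' i (fun y => k y t) x)
    {x : EuclideanSpace ℝ (Fin n)} (hx : x ∈ Ω) {t : ℝ} (ht : t ∈ Icc 0 T) :
    HasDerivWithinAt (fun t => pderiv' i (fun y => g y t) x) (pderiv' i (fun y => k y t) x)
      (Icc 0 T) t := by
  obtain ⟨G, hG, hGk⟩ := hext
  set e : EuclideanSpace ℝ (Fin n) := EuclideanSpace.single i (1 : ℝ) with he
  have hcont : ContinuousWithinAt (fun z : EuclideanSpace ℝ (Fin n) × ℝ => G z.1 z.2)
      (Ω ×ˢ Icc 0 T) (x, t) :=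
    (hG.mono (prod_mono subset_closure le_rfl)) _ ⟨hx, ht⟩
  have line : ∀ {f : EuclideanSpace ℝ (Fin n) → ℝ}, DifferentiableOn ℝ f Ω → ∀ {r : ℝ},
      x + r • e ∈ Ω → HasDerivAt (fun r : ℝ => f (x + r • e)) (pderiv' i f (x + r • e)) r :=
    fun hf r hr => hasDerivAt_line i (hf.differentiableAt (hΩ.mem_nhds hr))
  rw [hasDerivWithinAt_iff_isLittleO, Asymptotics.isLittleO_iff]
  intro η hη
  obtain ⟨δ, hδ, hδG⟩ := Metric.continuousWithinAt_iff.1 hcont η hη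
  obtain ⟨ρ, hρ, hρΩ⟩ := Metric.eventually_nhds_iff.1 ((tendsto_line x e).eventually
    ((hΩ.mem_nhds hx)))
  obtain ⟨ρ', hρ', hρδ⟩ := Metric.eventually_nhds_iff.1 ((tendsto_line x e).eventually
    (Metric.ball_mem_nhds x hδ))
  filter_upwards [self_mem_nhdsWithin, mem_nhdsWithin_of_mem_nhds (Metric.ball_mem_nhds t hδ)]
    with s hs hst
  set κ := pderiv' i (fun y => k y t) x with hκ
  have hball : Convex ℝ (Metric.ball (0 : ℝ) (min ρ ρ')) := convex_ball _ _
  have hsub : Convex ℝ (Icc 0 T ∩ Metric.ball t δ) := (convex_Icc _ _).inter (convex_ball _ _)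
  have h0 : (0 : ℝ) ∈ Metric.ball (0 : ℝ) (min ρ ρ') := Metric.mem_ball_self (lt_min hρ hρ')
  have hin : ∀ r ∈ Metric.ball (0 : ℝ) (min ρ ρ'), x + r • e ∈ Ω := fun r hr =>
    hρΩ (lt_of_lt_of_le hr (min_le_left _ _))
  have b1 : ∀ τ ∈ Icc 0 T ∩ Metric.ball t δ, ∀ r ∈ Metric.ball (0 : ℝ) (min ρ ρ'),
      ‖k (x + r • e) τ - k x τ - r * κ‖ ≤ η * ‖r‖ := by
    intro τ hτ r hr
    have := hball.norm_image_sub_le_of_norm_hasDerivWithin_le (C := η)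
      (f := fun r : ℝ => k (x + r • e) τ - r * κ)
      (f' := fun r => pderiv' i (fun y => k y τ) (x + r • e) - 1 * κ) (fun r hr =>
        ((line (hk τ hτ.1) (hin r hr)).sub ((hasDerivAt_id r).mul_const κ)).hasDerivWithinAt)
      (fun r hr => ?_) h0 hr
    · simpa [sub_right_comm] using this
    · have hd := @hδG (x + r • e, τ) ⟨hin r hr, hτ.1⟩ (by
        rw [Prod.dist_eq]
        exact max_lt (hρδ (lt_of_lt_of_le hr (min_le_right _ _))) hτ.2)
      simp only [hGk _ (hin r hr) τ hτ.1, hGk x hx t ht, dist_eq_norm] at hd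
      simpa using hd.le
  have b2 : ∀ r ∈ Metric.ball (0 : ℝ) (min ρ ρ'),
      ‖(g (x + r • e) s - g x s) - (g (x + r • e) t - g x t) - r * ((s - t) * κ)‖
        ≤ η * ‖r‖ * ‖s - t‖ := by
    intro r hr
    have := hsub.norm_image_sub_le_of_norm_hasDerivWithin_le (C := η * ‖r‖)
      (f := fun τ : ℝ => g (x + r • e) τ - g x τ - τ * (r * κ))
      (f' := fun τ => k (x + r • e) τ - k x τ - 1 * (r * κ)) (fun τ hτ =>
        (((hgk _ (hin r hr) τ hτ.1).sub (hgk x hx τ hτ.1)).sub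
          ((hasDerivWithinAt_id τ _).mul_const (r * κ))).mono inter_subset_left)
      (fun τ hτ => by simpa using b1 τ hτ r hr) (x := t) (y := s)
      ⟨ht, Metric.mem_ball_self hδ⟩ ⟨hs, hst⟩
    refine le_trans (le_of_eq ?_) this
    congr 1
    ring
  have hx' : x + (0 : ℝ) • e ∈ Ω := by simpa using hx
  have hD : HasDerivAt (fun r : ℝ => (g (x + r • e) s) - (g (x + r • e) t)  - r * ((s - t) * κ))
      (pderiv' i (fun y => g y s) x - pderiv' i (fun y => g y t) x - 1 * ((s - t) * κ)) 0 := by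
    have := ((line (hg s hs) hx').sub (line (hg t ht) hx')).sub
      ((hasDerivAt_id (0 : ℝ)).mul_const ((s - t) * κ))
    simp only [zero_smul, add_zero] at this
    exact this
  have hb := hD.le_of_lip' (C := η * ‖s - t‖) (by positivity) (by
    filter_upwards [Metric.ball_mem_nhds (0 : ℝ) (lt_min hρ hρ')] with r hr
    refine le_trans (le_of_eq ?_) (le_trans (b2 r hr) (le_of_eq ?_))
    · congr 1
      simp
      ring
    · simp
      ring)
  simpa using hb

lemma continuous_lap {n : ℕ} {h : EuclideanSpace ℝ (Fin n) → ℝ}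
    (hh : ContDiff ℝ (⊤ : ℕ∞) h) : Continuous (lap h) := by
  refine continuous_finsetSum _ fun i _ => ?_
  have h1 : ContDiffOn ℝ (⊤ : ℕ∞) (pderiv' i h) univ :=
    contDiffOn_pderiv' isOpen_univ i hh.contDiffOn (by norm_cast)
  have h2 : ContDiffOn ℝ (⊤ : ℕ∞) (pderiv' i (pderiv' i h)) univ :=
    contDiffOn_pderiv' isOpen_univ i h1 (by norm_cast)
  exact continuousOn_univ.1 h2.continuousOn

lemma hasFDerivAt_exp_neg_sq {n : ℕ} {Φ : EuclideanSpace ℝ (Fin n) → ℝ} {K : ℝ}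
    {x : EuclideanSpace ℝ (Fin n)} (hΦ : DifferentiableAt ℝ Φ x) :
    HasFDerivAt (fun x => exp (-K * (Φ x * Φ x)))
      ((Φ x * (-2 * K * exp (-K * (Φ x * Φ x)))) • fderiv ℝ Φ x) x := by
  have h := (((hΦ.hasFDerivAt.mul hΦ.hasFDerivAt).const_mul (-K)).exp)
  refine h.congr_fderiv ?_
  ext v
  simp
  ring

/-- A positive smooth function which is a strict supersolution of `Δ + b` on the boundary. -/
lemma exists_boundary_supersolution {n : ℕ} {Ω : Set (EuclideanSpace ℝ (Fin n))}
    (hΩ : IsSmoothDomain Ω) (b : ℝ) :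
    ∃ h : EuclideanSpace ℝ (Fin n) → ℝ, ContDiff ℝ (⊤ : ℕ∞) h ∧ (∀ x, 0 < h x) ∧
      ∀ x ∈ frontier Ω, lap h x + b * h x < 0 := by
  obtain ⟨-, hbdd, -, Φ, hΦ, -, hfr, hgrad⟩ := hΩ
  have hΦd : Differentiable ℝ Φ := hΦ.differentiable (by simp)
  have hpc : ∀ i, ContDiff ℝ (⊤ : ℕ∞) (pderiv' i Φ) := fun i =>
    contDiffOn_univ.1 (contDiffOn_pderiv' isOpen_univ i hΦ.contDiffOn (by norm_cast))
  set S : EuclideanSpace ℝ (Fin n) → ℝ := fun x => ∑ i, pderiv' i Φ x ^ 2 with hS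
  have hSc : Continuous S := continuous_finsetSum _ fun i _ => (hpc i).continuous.pow 2
  have hSpos : ∀ x ∈ frontier Ω, 0 < S x := by
    intro x hx
    refine lt_of_le_of_ne (Finset.sum_nonneg fun i _ => sq_nonneg _) fun h0 => hgrad x hx ?_
    have hz := (Finset.sum_eq_zero_iff_of_nonneg fun i _ => sq_nonneg _).1 h0.symm
    have hf : fderiv ℝ Φ x = 0 := by
      ext v
      rw [← (EuclideanSpace.basisFun (Fin n) ℝ).sum_repr v, map_sum]
      refine Finset.sum_eq_zero fun i hi => ?_
      have := pow_eq_zero_iff (two_ne_zero) |>.1 (hz i hi)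
      rw [pderiv'] at this
      simp [this]
    simp [gradient, hf]
  have hcomp : IsCompact (frontier Ω) :=
    hbdd.isCompact_closure.of_isClosed_subset isClosed_frontier frontier_subset_closure
  obtain ⟨M, hM⟩ := hcomp.exists_bound_of_continuousOn (f := fun x => (S x)⁻¹)
    (hSc.continuousOn.inv₀ fun x hx => (hSpos x hx).ne')
  set K := |b| * |M| + 1 with hK
  have hK' : ∀ x ∈ frontier Ω, 2 * K * S x > b := by
    intro x hx
    have h1 := hSpos x hx
    have h2 : (S x)⁻¹ ≤ |M| := (le_abs_self _).trans ((hM x hx).trans (le_abs_self M))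
    have h3 : 1 ≤ |M| * S x := by
      have := mul_le_mul_of_nonneg_right h2 h1.le
      rwa [inv_mul_cancel₀ h1.ne'] at this
    have h4 : |b| ≤ |b| * (|M| * S x) := le_mul_of_one_le_right (abs_nonneg b) h3
    have h5 : 0 ≤ |b| * (|M| * S x) := (abs_nonneg b).trans h4
    rw [hK]
    nlinarith [le_abs_self b]
  have hd1 : ∀ i, pderiv' i (fun x => exp (-K * (Φ x * Φ x))) =
      fun x => Φ x * (-2 * K * exp (-K * (Φ x * Φ x)) * pderiv' i Φ x) := by
    intro i
    ext x
    rw [pderiv', (hasFDerivAt_exp_neg_sq (hΦd x)).fderiv, pderiv']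
    simp
    ring
  refine ⟨fun x => exp (-K * (Φ x * Φ x)), by fun_prop, fun x => exp_pos _, fun x hx => ?_⟩
  have hx0 : Φ x = 0 := by
    rw [hfr] at hx
    exact hx
  have hd2 : ∀ i, pderiv' i (pderiv' i (fun x => exp (-K * (Φ x * Φ x)))) x =
      -2 * K * pderiv' i Φ x ^ 2 := by
    intro i
    have hq : DifferentiableAt ℝ
        (fun x => -2 * K * exp (-K * (Φ x * Φ x)) * pderiv' i Φ x) x := by
      have := hpc i
      have : ContDiff ℝ (⊤ : ℕ∞) (fun x => -2 * K * exp (-K * (Φ x * Φ x)) * pderiv' i Φ x) := by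
        fun_prop
      exact this.differentiable (by simp) x
    rw [hd1, pderiv', fderiv_fun_mul (hΦd x) hq]
    simp [hx0, pderiv']
    ring
  have : lap (fun x => exp (-K * (Φ x * Φ x))) x = -2 * K * S x := by
    rw [lap, hS, Finset.mul_sum]
    exact Finset.sum_congr rfl fun i _ => hd2 i
  simp only [this, hx0, mul_zero, exp_zero, mul_one]
  linarith [hK' x hx]

/-- The time derivative of a function vanishing on the lateral boundary vanishes there. -/
lemma time_deriv_eq_zero_on_frontier {n : ℕ} {Ω : Set (EuclideanSpace ℝ (Fin n))} {T : ℝ}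
    (hT : 0 < T) {u ut : EuclideanSpace ℝ (Fin n) → ℝ → ℝ}
    (hd : ∀ x ∈ Ω, ∀ t ∈ Icc 0 T, HasDerivWithinAt (u x) (ut x t) (Icc 0 T) t)
    (hu : ContinuousOn (fun z : EuclideanSpace ℝ (Fin n) × ℝ => u z.1 z.2)
      (closure Ω ×ˢ Icc 0 T))
    (hut : ContinuousOn (fun z : EuclideanSpace ℝ (Fin n) × ℝ => ut z.1 z.2)
      (closure Ω ×ˢ Icc 0 T))
    (h0 : ∀ x ∈ frontier Ω, ∀ t ∈ Icc 0 T, u x t = 0)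
    {x : EuclideanSpace ℝ (Fin n)} (hx : x ∈ frontier Ω) {t : ℝ} (ht : t ∈ Icc 0 T) :
    ut x t = 0 := by
  by_contra hne
  have hxc : x ∈ closure Ω := frontier_subset_closure hx
  have hη : 0 < ‖ut x t‖ / 2 := by positivity
  obtain ⟨δ, hδ, hδu⟩ := Metric.continuousWithinAt_iff.1 (hut (x, t) ⟨hxc, ht⟩) _ hη
  obtain ⟨s, hs, hst, hsδ⟩ : ∃ s ∈ Icc 0 T, s ≠ t ∧ |s - t| < δ := by
    rcases ht.2.lt_or_eq with h | h
    · have h1 : 0 < min (T - t) (δ / 2) := lt_min (by linarith) (by linarith)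
      refine ⟨t + min (T - t) (δ / 2), ⟨by linarith [ht.1], by
        linarith [min_le_left (T - t) (δ / 2)]⟩, by linarith, ?_⟩
      rw [add_sub_cancel_left, abs_of_pos h1]
      linarith [min_le_right (T - t) (δ / 2)]
    · have h1 : 0 < min T (δ / 2) := lt_min hT (by linarith)
      refine ⟨t - min T (δ / 2), ⟨by linarith [min_le_left T (δ / 2)], by linarith⟩,
        by linarith, ?_⟩
      rw [sub_sub_cancel_left, abs_neg, abs_of_pos h1]
      linarith [min_le_right T (δ / 2)]
  have hconv : Convex ℝ (Icc 0 T ∩ Metric.ball t δ) := (convex_Icc _ _).inter (convex_ball _ _)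
  have hnear : ∀ y ∈ Ω ∩ Metric.ball x δ,
      ‖u y s - u y t - (s - t) * ut x t‖ ≤ ‖ut x t‖ / 2 * ‖s - t‖ := by
    intro y hy
    have := hconv.norm_image_sub_le_of_norm_hasDerivWithin_le (C := ‖ut x t‖ / 2)
      (f := fun τ => u y τ - τ * ut x t) (f' := fun τ => ut y τ - 1 * ut x t)
      (fun τ hτ => ((hd y hy.1 τ hτ.1).sub
        ((hasDerivWithinAt_id τ _).mul_const _)).mono inter_subset_left)
      (fun τ hτ => ?_) (x := t) (y := s) ⟨ht, Metric.mem_ball_self hδ⟩ ⟨hs, hsδ⟩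
    · refine le_trans (le_of_eq ?_) this
      congr 1
      ring
    · have := @hδu (y, τ) ⟨subset_closure hy.1, hτ.1⟩ (by
        rw [Prod.dist_eq]
        exact max_lt hy.2 hτ.2)
      rw [dist_eq_norm] at this
      simpa using this.le
  have hneb : (𝓝[Ω] x).NeBot := mem_closure_iff_nhdsWithin_neBot.1 hxc
  have hlim : ∀ r ∈ Icc 0 T, Tendsto (fun y => u y r) (𝓝[Ω] x) (𝓝 0) := by
    intro r hr
    have h1 : ContinuousOn (fun y => u y r) (closure Ω) :=
      hu.comp (f := fun y => (y, r)) (by fun_prop) fun y hy => ⟨hy, hr⟩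
    have h2 := ((h1 x hxc).mono subset_closure).tendsto
    rwa [h0 x hx r hr] at h2
  have hl := (((hlim s hs).sub (hlim t ht)).sub_const ((s - t) * ut x t)).norm
  have hfin := le_of_tendsto hl (by
    filter_upwards [inter_mem_nhdsWithin Ω (Metric.ball_mem_nhds x hδ)] with y hy
    exact hnear y hy)
  have hp : 0 < ‖s - t‖ := norm_pos_iff.2 (sub_ne_zero.2 hst)
  rw [sub_zero, zero_sub, norm_neg, norm_mul] at hfin
  nlinarith

/-- The equation of the fast diffusion setting in non-divergence form, and the equation obtained
from it by differentiating in time. -/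
lemma FDSetting.equations {n : ℕ} {Ω : Set (EuclideanSpace ℝ (Fin n))} {p b T c₀ : ℝ}
    {u ut utt : EuclideanSpace ℝ (Fin n) → ℝ → ℝ} (H : FDSetting Ω p b T c₀ u ut utt)
    {x : EuclideanSpace ℝ (Fin n)} (hx : x ∈ Ω) {t : ℝ} (ht : t ∈ Ioc 0 T) :
    p * u x t ^ (p - 1) * ut x t = lap (fun y => u y t) x + b * u x t + u x t * u x t ^ (p - 1) ∧
    p * (p - 1) * (u x t ^ (p - 1) / u x t) * ut x t ^ 2 + p * u x t ^ (p - 1) * utt x t =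
      lap (fun y => ut y t) x + b * ut x t + p * u x t ^ (p - 1) * ut x t := by
  obtain ⟨hΩ, hp, -, hT, -, ⟨hu3, hut2, hdu, hdut, -, -, -, -, -, -, hext1, hext2⟩, hpos, hpde,
    -, -⟩ := H
  have hopen := hΩ.1
  have hun : ∀ t ∈ Icc 0 T, UniqueDiffWithinAt ℝ (Icc 0 T) t := uniqueDiffOn_Icc hT
  have hrpow : ∀ t ∈ Icc 0 T, u x t ^ p = u x t * u x t ^ (p - 1) := fun t ht => by
    rw [rpow_sub_one (hpos x hx t ht).ne']
    field_simp [(hpos x hx t ht).ne']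
  have e1 : ∀ t ∈ Ioc 0 T, p * u x t ^ (p - 1) * ut x t =
      lap (fun y => u y t) x + b * u x t + u x t * u x t ^ (p - 1) := by
    intro t ht
    have ht' : t ∈ Icc 0 T := Ioc_subset_Icc_self ht
    have h1 := (hdu x hx t ht').rpow_const (p := p) (Or.inl (hpos x hx t ht').ne')
    have h2 := (hun t ht').eq_deriv _ h1 (hpde x hx t ht)
    rw [← hrpow t ht', ← h2]
    ring
  refine ⟨e1 t ht, ?_⟩
  have ht' : t ∈ Icc 0 T := Ioc_subset_Icc_self ht
  have dlap : HasDerivWithinAt (fun t => lap (fun y => u y t) x) (lap (fun y => ut y t) x)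
      (Icc 0 T) t := by
    refine HasDerivWithinAt.fun_sum fun i _ => ?_
    refine hasDerivWithinAt_pderiv' hopen (g := fun y t => pderiv' i (fun y => u y t) y)
      (k := fun y t => pderiv' i (fun y => ut y t) y) i (fun t ht => ?_) (fun t ht => ?_)
      (fun y hy t ht => ?_) (hext2 i i) hx ht'
    · exact (contDiffOn_pderiv' (k := 2) hopen i (hu3 t ht) (by norm_num)).differentiableOn
        (by norm_num)
    · exact (contDiffOn_pderiv' (k := 1) hopen i (hut2 t ht) (by norm_num)).differentiableOn
        (by norm_num)
    · exact hasDerivWithinAt_pderiv' hopen i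
        (fun t ht => (hu3 t ht).differentiableOn (by norm_num))
        (fun t ht => (hut2 t ht).differentiableOn (by norm_num)) hdu (hext1 i) hy ht
  have h0 := (hpos x hx t ht').ne'
  have dpow := (hdu x hx t ht').rpow_const (p := p - 1) (Or.inl h0)
  have dL := (dpow.const_mul p).mul (hdut x hx t ht')
  have dR := (dlap.add ((hdu x hx t ht').const_mul b)).add ((hdu x hx t ht').mul dpow)
  have hev : (fun t => lap (fun y => u y t) x + b * u x t + u x t * u x t ^ (p - 1))
      =ᶠ[𝓝[Icc 0 T] t] fun t => p * u x t ^ (p - 1) * ut x t := by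
    filter_upwards [self_mem_nhdsWithin, mem_nhdsWithin_of_mem_nhds (Ioi_mem_nhds ht.1)]
      with s hs hs0
    exact (e1 s ⟨hs0, hs.2⟩).symm
  have := (hun t ht').eq_deriv _ dL (dR.congr_of_eventuallyEq hev.symm (e1 t ht))
  rw [rpow_sub_one h0] at this
  field_simp at this ⊢
  linear_combination this

/-- The pointwise inequalities at a first contact point are incompatible. -/
lemma contact_contradiction {p b a u v vt Lu Lv Lh f f' c h B : ℝ} (hp : 1 < p) (ha : 0 < a)
    (hu : 0 < u) (hc : 0 < c) (hh : 0 < h) (hf : 0 < f)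
    (e1 : p * a * v = Lu + b * u + u * a)
    (e2 : p * (p - 1) * (a / u) * v ^ 2 + p * a * vt = Lv + b * v + p * a * v)
    (hS : Lv - f * Lu - c * Lh ≤ 0) (hW : v - f * u = c * h)
    (hT : 0 ≤ vt - (f' * u + f * v) - (1 + B) * c * h)
    (hB : Lh + b * h ≤ B * h * p * a)
    (hode : 0 < p * f' + p * (p - 1) * f ^ 2 - (p - 1) * f) : False := by
  have hfu : f ^ 2 * u ≤ v ^ 2 / u := by
    rw [le_div_iff₀ hu]
    have : f * u ≤ v := by nlinarith
    nlinarith [mul_pos hf hu]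
  have e2' : p * (p - 1) * (a / u) * v ^ 2 = a * (p * (p - 1) * (v ^ 2 / u)) := by ring
  rw [e2'] at e2
  have h1 : p * (p - 1) * (f ^ 2 * u) ≤ p * (p - 1) * (v ^ 2 / u) :=
    mul_le_mul_of_nonneg_left hfu (by nlinarith)
  have h2 := mul_nonneg (mul_pos (by linarith : 0 < p) ha).le hT
  have h3 := mul_le_mul_of_nonneg_left hB hc.le
  have h4 := mul_le_mul_of_nonneg_left h1 ha.le
  have h5 := mul_pos (mul_pos ha hu) hode
  have hv : v = f * u + c * h := by linarith
  have h6 : 0 < c * h := mul_pos hc hh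
  subst hv
  have e1' : f * (p * a * (f * u + c * h)) = f * (Lu + b * u + u * a) := by rw [e1]
  nlinarith

/-- The zeroth order term produced by a boundary supersolution is controlled by the weight
`u ^ (p - 1)`. -/
lemma exists_weight_bound {n : ℕ} {Ω : Set (EuclideanSpace ℝ (Fin n))} {p T : ℝ} (hp : 1 < p)
    (hopen : IsOpen Ω) (hbdd : Bornology.IsBounded Ω) {u : EuclideanSpace ℝ (Fin n) → ℝ → ℝ}
    (hu : ContinuousOn (fun z : EuclideanSpace ℝ (Fin n) × ℝ => u z.1 z.2)
      (closure Ω ×ˢ Icc 0 T))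
    (hpos : ∀ x ∈ Ω, ∀ t ∈ Icc 0 T, 0 < u x t) {F h : EuclideanSpace ℝ (Fin n) → ℝ}
    (hF : Continuous F) (hh : Continuous h) (hh0 : ∀ x, 0 < h x)
    (hFfr : ∀ x ∈ frontier Ω, F x < 0) :
    ∃ B : ℝ, 0 ≤ B ∧ ∀ x ∈ Ω, ∀ t ∈ Icc 0 T, F x ≤ B * h x * p * u x t ^ (p - 1) := by
  set S := closure Ω ∩ {x | 0 ≤ F x} with hS
  have hScomp : IsCompact S :=
    hbdd.isCompact_closure.inter_right (isClosed_le continuous_const hF)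
  have hSΩ : S ⊆ Ω := fun x hx => by
    by_contra hxΩ
    have : x ∈ frontier Ω := by
      rw [hopen.frontier_eq]
      exact ⟨hx.1, hxΩ⟩
    exact absurd hx.2 (not_le.2 (hFfr x this))
  have hden : ∀ x ∈ Ω, ∀ t ∈ Icc 0 T, 0 < h x * p * u x t ^ (p - 1) := fun x hx t ht =>
    mul_pos (mul_pos (hh0 x) (by linarith)) (rpow_pos_of_pos (hpos x hx t ht) _)
  have hcont : ContinuousOn (fun z : EuclideanSpace ℝ (Fin n) × ℝ =>
      F z.1 / (h z.1 * p * u z.1 z.2 ^ (p - 1))) (S ×ˢ Icc 0 T) := by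
    refine ContinuousOn.div (by fun_prop) (ContinuousOn.mul (by fun_prop) ?_)
      fun z hz => (hden _ (hSΩ hz.1) _ hz.2).ne'
    exact (hu.mono (prod_mono inter_subset_left le_rfl)).rpow_const
      fun z hz => Or.inl (hpos _ (hSΩ hz.1) _ hz.2).ne'
  obtain ⟨B, hB⟩ := (hScomp.prod isCompact_Icc).exists_bound_of_continuousOn hcont
  refine ⟨|B|, abs_nonneg B, fun x hx t ht => ?_⟩
  have hd := hden x hx t ht
  have hassoc : |B| * h x * p * u x t ^ (p - 1) = |B| * (h x * p * u x t ^ (p - 1)) := by ring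
  rw [hassoc]
  rcases le_or_gt 0 (F x) with h0 | h0
  · rw [← div_le_iff₀ hd]
    exact (le_abs_self _).trans
      ((hB (x, t) ⟨⟨subset_closure hx, h0⟩, ht⟩).trans (le_abs_self B))
  · exact h0.le.trans (mul_nonneg (abs_nonneg B) hd.le)

/-- If `v` is continuous on a compact cylinder and vanishes on the lateral boundary, while `u` is
positive inside, then `v ≤ ε h + K u` for some constant `K`. -/
lemma exists_le_add_mul {n : ℕ} {Ω : Set (EuclideanSpace ℝ (Fin n))} {T : ℝ}
    (hopen : IsOpen Ω) (hbdd : Bornology.IsBounded Ω) {u v : EuclideanSpace ℝ (Fin n) → ℝ → ℝ}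
    (hu : ContinuousOn (fun z : EuclideanSpace ℝ (Fin n) × ℝ => u z.1 z.2)
      (closure Ω ×ˢ Icc 0 T))
    (hv : ContinuousOn (fun z : EuclideanSpace ℝ (Fin n) × ℝ => v z.1 z.2)
      (closure Ω ×ˢ Icc 0 T))
    (hpos : ∀ x ∈ Ω, ∀ t ∈ Icc 0 T, 0 < u x t)
    (hv0 : ∀ x ∈ frontier Ω, ∀ t ∈ Icc 0 T, v x t = 0) {h : EuclideanSpace ℝ (Fin n) → ℝ}
    (hh : Continuous h) (hh0 : ∀ x, 0 < h x) :
    ∃ K : ℝ, 0 ≤ K ∧ ∀ x ∈ Ω, ∀ t ∈ Icc 0 T, v x t ≤ h x + K * u x t := by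
  have hcomp : IsCompact (closure Ω ×ˢ Icc 0 T) := hbdd.isCompact_closure.prod isCompact_Icc
  have hdiff : ContinuousOn (fun z : EuclideanSpace ℝ (Fin n) × ℝ => v z.1 z.2 - h z.1)
      (closure Ω ×ˢ Icc 0 T) := hv.sub (by fun_prop)
  set S := (closure Ω ×ˢ Icc 0 T) ∩
    (fun z : EuclideanSpace ℝ (Fin n) × ℝ => v z.1 z.2 - h z.1) ⁻¹' Ici 0 with hS
  have hScomp : IsCompact S := hcomp.of_isClosed_subset
    (hdiff.preimage_isClosed_of_isClosed hcomp.isClosed isClosed_Ici) inter_subset_left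
  have hSΩ : ∀ z ∈ S, z.1 ∈ Ω := fun z hz => by
    by_contra hxΩ
    have hfr : z.1 ∈ frontier Ω := by
      rw [hopen.frontier_eq]
      exact ⟨hz.1.1, hxΩ⟩
    have h1 : 0 ≤ v z.1 z.2 - h z.1 := hz.2
    rw [hv0 _ hfr _ hz.1.2] at h1
    linarith [hh0 z.1]
  obtain ⟨K, hK⟩ := hScomp.exists_bound_of_continuousOn
    (f := fun z : EuclideanSpace ℝ (Fin n) × ℝ => v z.1 z.2 / u z.1 z.2)
    ((hv.mono inter_subset_left).div (hu.mono inter_subset_left)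
      fun z hz => (hpos _ (hSΩ z hz) _ hz.1.2).ne')
  refine ⟨|K|, abs_nonneg K, fun x hx t ht => ?_⟩
  have hu0 := hpos x hx t ht
  by_cases hxt : 0 ≤ v x t - h x
  · have h1 := (le_abs_self _).trans
      ((hK (x, t) ⟨⟨subset_closure hx, ht⟩, hxt⟩).trans (le_abs_self K))
    rw [div_le_iff₀ hu0] at h1
    linarith [hh0 x]
  · nlinarith [mul_nonneg (abs_nonneg K) hu0.le]

/-- Bénilan–Crandall type estimate for the fast diffusion setting. -/
lemma FDSetting.time_deriv_le {n : ℕ} {Ω : Set (EuclideanSpace ℝ (Fin n))} {p b T c₀ : ℝ}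
    {u ut utt : EuclideanSpace ℝ (Fin n) → ℝ → ℝ} (H : FDSetting Ω p b T c₀ u ut utt)
    {x : EuclideanSpace ℝ (Fin n)} (hx : x ∈ Ω) {t : ℝ} (ht : t ∈ Ioc 0 T) :
    ut x t ≤ (((p - 1) * t)⁻¹ + 1) * u x t := by
  have heq := fun {x} hx {t} ht => @FDSetting.equations n Ω p b T c₀ u ut utt H x hx t ht
  obtain ⟨hΩ, hp, -, hT, -, ⟨hu3, hut2, hdu, hdut, hcu, hcut, -, -, -, -, -, -⟩, hpos, -,
    hu0, -⟩ := H
  have hopen := hΩ.1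
  have hbdd := hΩ.2.1
  have hp1 : 0 < p - 1 := by linarith
  have hut0 : ∀ x ∈ frontier Ω, ∀ t ∈ Icc 0 T, ut x t = 0 := fun x hx t ht =>
    time_deriv_eq_zero_on_frontier hT hdu hcu hcut hu0 hx ht
  obtain ⟨h, hh, hh0, hhfr⟩ := exists_boundary_supersolution hΩ b
  obtain ⟨B, hB0, hB⟩ := exists_weight_bound hp hopen hbdd hcu hpos
    (F := fun x => lap h x + b * h x)
    ((continuous_lap hh).add (continuous_const.mul hh.continuous)) hh.continuous hh0 hhfr
  set f : ℝ → ℝ := fun t => ((p - 1) * t)⁻¹ + 1 with hf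
  by_contra! hcon
  have hfpos : ∀ t, 0 < t → 0 < f t := fun t ht => by
    have := mul_pos hp1 ht
    simp only [hf]
    positivity
  set Q : EuclideanSpace ℝ (Fin n) × ℝ → ℝ := fun z =>
    exp (-(1 + B) * z.2) * (ut z.1 z.2 - f z.2 * u z.1 z.2) / h z.1 with hQ
  have hwpos : 0 < ut x t - f t * u x t := sub_pos.2 hcon
  have hQpos : 0 < Q (x, t) := div_pos (mul_pos (exp_pos _) hwpos) (hh0 x)
  obtain ⟨K, hK0, hK⟩ := exists_le_add_mul hopen hbdd hcu hcut hpos hut0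
    (h := fun y => Q (x, t) / 2 * h y) (continuous_const.mul hh.continuous)
    (fun y => mul_pos (by linarith) (hh0 y))
  -- before time `τ` the function `f` is larger than `K`
  set τ : ℝ := min (t / 2) ((p - 1) * (K + 1))⁻¹ with hτ
  have hK1 : 0 < (p - 1) * (K + 1) := by positivity
  have hτ0 : 0 < τ := lt_min (by linarith [ht.1]) (by positivity)
  have hτt : τ < t := (min_le_left _ _).trans_lt (by linarith [ht.1])
  have hfτ : K ≤ f τ := by
    have h1 : (p - 1) * τ ≤ (K + 1)⁻¹ := by
      have := mul_le_mul_of_nonneg_left (min_le_right (t / 2) ((p - 1) * (K + 1))⁻¹) hp1.le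
      rw [← hτ] at this
      refine this.trans (le_of_eq ?_)
      field_simp
    have h2 := inv_anti₀ (mul_pos hp1 hτ0) h1
    rw [inv_inv] at h2
    simp only [hf]
    linarith
  have hsub : Icc τ T ⊆ Icc 0 T := Icc_subset_Icc_left hτ0.le
  have hfc : ContinuousOn f (Icc τ T) := by
    refine ContinuousOn.add (ContinuousOn.inv₀ (by fun_prop) fun s hs => ?_) continuousOn_const
    exact (mul_pos hp1 (hτ0.trans_le hs.1)).ne'
  have hQc : ContinuousOn Q (closure Ω ×ˢ Icc τ T) := by
    refine ContinuousOn.div (ContinuousOn.mul (by fun_prop) (ContinuousOn.sub ?_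
      (ContinuousOn.mul ?_ ?_))) ?_ fun z _ => (hh0 z.1).ne'
    · exact hcut.mono (prod_mono le_rfl hsub)
    · exact hfc.comp continuousOn_snd fun z hz => hz.2
    · exact hcu.mono (prod_mono le_rfl hsub)
    · exact (hh.continuous.comp continuous_fst).continuousOn
  have hmem : (x, t) ∈ closure Ω ×ˢ Icc τ T := ⟨subset_closure hx, hτt.le, ht.2⟩
  obtain ⟨⟨y, s⟩, ⟨hy, hs⟩, hmax⟩ :=
    (hbdd.isCompact_closure.prod isCompact_Icc).exists_isMaxOn ⟨_, hmem⟩ hQc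
  simp only at hy hs
  set c := Q (y, s) with hc
  have hQc' : Q (x, t) ≤ c := hmax hmem
  have hcpos : 0 < c := hQpos.trans_le hQc'
  have hyΩ : y ∈ Ω := by
    by_contra hyΩ
    have hfr : y ∈ frontier Ω := by
      rw [hopen.frontier_eq]
      exact ⟨hy, hyΩ⟩
    have : c = 0 := by
      simp [hc, hQ, hu0 y hfr s (hsub hs), hut0 y hfr s (hsub hs)]
    linarith
  have hle : ∀ z ∈ Ω, ∀ r ∈ Icc τ T,
      ut z r - f r * u z r - c * exp ((1 + B) * r) * h z ≤ 0 := by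
    intro z hz r hr
    have h1 : Q (z, r) ≤ c := hmax (show (z, r) ∈ closure Ω ×ˢ Icc τ T from ⟨subset_closure hz, hr⟩)
    simp only [hQ] at h1
    rw [div_le_iff₀ (hh0 z), neg_mul, exp_neg, inv_mul_le_iff₀ (exp_pos _)] at h1
    linarith
  have heqc : ut y s - f s * u y s = c * exp ((1 + B) * s) * h y := by
    have h1 : exp (-(1 + B) * s) * (ut y s - f s * u y s) / h y = c := rfl
    rw [div_eq_iff (hh0 y).ne', neg_mul, exp_neg, inv_mul_eq_iff_eq_mul₀ (exp_pos _).ne'] at h1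
    linarith
  have hτs : τ < s := by
    refine lt_of_le_of_ne hs.1 fun hst => ?_
    have hs' := hsub hs
    have h1 := hK y hyΩ s hs'
    have h2 : K * u y s ≤ f s * u y s :=
      mul_le_mul_of_nonneg_right (hst ▸ hfτ) (hpos y hyΩ s hs').le
    have h3 : 1 ≤ exp ((1 + B) * s) := one_le_exp (mul_nonneg (by linarith) hs'.1)
    have h4 : c * h y ≤ c * exp ((1 + B) * s) * h y := by
      nlinarith [mul_pos hcpos (hh0 y)]
    have h5 : Q (x, t) / 2 * h y < c * h y := mul_lt_mul_of_pos_right (by linarith) (hh0 y)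
    linarith
  have hs0 : 0 < s := hτ0.trans hτs
  have hsIoc : s ∈ Ioc 0 T := ⟨hs0, hs.2⟩
  have hsIcc : s ∈ Icc 0 T := hsub hs
  obtain ⟨e1, e2⟩ := heq hyΩ hsIoc
  have hS : lap (fun z => ut z s) y - f s * lap (fun z => u z s) y
      - c * exp ((1 + B) * s) * lap h y ≤ 0 :=
    lap_comb_nonpos hopen (hut2 s hsIcc) ((hu3 s hsIcc).of_le (by norm_num))
      (hh.contDiffOn.of_le (by norm_cast)) hyΩ fun z hz => by
        have h1 := hle z hz s hs
        linarith
  have hdf : HasDerivAt f (-(p - 1) / ((p - 1) * s) ^ 2) s := by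
    have := (((hasDerivAt_id s).const_mul (p - 1)).inv (mul_pos hp1 hs0).ne').add_const (1 : ℝ)
    exact this.congr_deriv (by simp)
  have hde : HasDerivAt (fun r => c * exp ((1 + B) * r) * h y)
      ((1 + B) * (c * exp ((1 + B) * s)) * h y) s := by
    have := ((((hasDerivAt_id s).const_mul (1 + B)).exp).const_mul c).mul_const (h y)
    refine this.congr_deriv ?_
    simp only [id]
    ring
  have hTm : 0 ≤ utt y s - (-(p - 1) / ((p - 1) * s) ^ 2 * u y s + f s * ut y s)
      - (1 + B) * (c * exp ((1 + B) * s)) * h y := by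
    refine deriv_nonneg_of_le_past (τ := τ)
      (φ := fun r => ut y r - f r * u y r - c * exp ((1 + B) * r) * h y) hτs
      ((((hdut y hyΩ s hsIcc).sub (hdf.hasDerivWithinAt.mul (hdu y hyΩ s hsIcc))).sub
        hde.hasDerivWithinAt).mono (Icc_subset_Icc hτ0.le hs.2)) fun r hr => ?_
    have h1 := hle y hyΩ r ⟨hr.1, hr.2.trans hs.2⟩
    linarith
  refine contact_contradiction hp (rpow_pos_of_pos (hpos y hyΩ s hsIcc) _) (hpos y hyΩ s hsIcc)
    (mul_pos hcpos (exp_pos _)) (hh0 y) (hfpos s hs0) e1 e2 hS heqc hTm (hB y hyΩ s hsIcc) ?_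
  have hode : p * (-(p - 1) / ((p - 1) * s) ^ 2) + p * (p - 1) * f s ^ 2 - (p - 1) * f s =
      (2 * p - 1) * s⁻¹ + (p - 1) ^ 2 := by
    simp only [hf]
    field_simp
    ring
  rw [hode]
  have : 0 < (2 * p - 1) * s⁻¹ := mul_pos (by linarith) (inv_pos.2 hs0)
  positivity

/-- Improved upper bound for the time derivative (Proposition 4.3 of the paper):
`∂ₜu ≤ C d(x)` on `closure Ω × [T/2, T]`.  The constant depends only on `n`, `Ω`,
`b`, `T`, `p`, `c₀` and (an upper bound `E` for) `∫_Ω |∇u(·,0)|²`. -/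
theorem stmt10 (n : ℕ) (hn : 1 ≤ n) (Ω : Set (EuclideanSpace ℝ (Fin n)))
    (p b c₀ T E : ℝ) :
    ∃ C : ℝ, 0 < C ∧
      ∀ (u ut utt : EuclideanSpace ℝ (Fin n) → ℝ → ℝ),
        FDSetting Ω p b T c₀ u ut utt →
        (∫ x in Ω, ‖gradient (fun y => u y 0) x‖ ^ 2) ≤ E →
        ∀ x ∈ closure Ω, ∀ t ∈ Set.Icc (T / 2) T, ut x t ≤ C * dB Ω x := by
  set M : ℝ := ((p - 1) * (T / 2))⁻¹ + 1 with hM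
  refine ⟨|M * c₀| + 1, by positivity, fun u ut utt H _ => ?_⟩
  have hbound := fun {x} hx {t} ht => @FDSetting.time_deriv_le n Ω p b T c₀ u ut utt H x hx t ht
  obtain ⟨hΩ, hp, -, hT, hc₀, ⟨-, -, hdu, -, hcu, hcut, -, -, -, -, -, -⟩, hpos, -, hu0, hud⟩ := H
  intro x hx t ht
  have ht' : t ∈ Icc 0 T := ⟨by linarith [ht.1], ht.2⟩
  have hd : 0 ≤ dB Ω x := Metric.infDist_nonneg
  by_cases hxΩ : x ∈ Ω
  · have h1 := hbound hxΩ (t := t) ⟨by linarith [ht.1], ht.2⟩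
    have hp1 : 0 < p - 1 := by linarith
    have h2 : ((p - 1) * t)⁻¹ + 1 ≤ M := by
      have : ((p - 1) * t)⁻¹ ≤ ((p - 1) * (T / 2))⁻¹ :=
        inv_anti₀ (by positivity) (mul_le_mul_of_nonneg_left ht.1 hp1.le)
      linarith
    have hM0 : 0 ≤ M := by positivity
    calc ut x t ≤ (((p - 1) * t)⁻¹ + 1) * u x t := h1
      _ ≤ M * u x t := mul_le_mul_of_nonneg_right h2 (hpos x hxΩ t ht').le
      _ ≤ M * (c₀ * dB Ω x) := mul_le_mul_of_nonneg_left (hud x hxΩ t ht').2 hM0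
      _ = (M * c₀) * dB Ω x := by ring
      _ ≤ (|M * c₀| + 1) * dB Ω x :=
        mul_le_mul_of_nonneg_right (by linarith [le_abs_self (M * c₀)]) hd
  · have hfr : x ∈ frontier Ω := by
      rw [hΩ.1.frontier_eq]
      exact ⟨hx, hxΩ⟩
    rw [time_deriv_eq_zero_on_frontier hT hdu hcu hcut hu0 hfr ht']
    positivity
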